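/- Let s∈(0,1) and let K satisfy (K1) and (K2). Let C̄, κ ∈ (0,∞) and σ, τ ∈ (1,∞). Let φ ∈ C^{1,1}(ℝ) be a nonnegative function such that φ(x) ≤ C̄|x|^{−σ} for x < −κ and φ(x) ≤ C̄|x|^{−τ} for x > κ, and such that φ(x) ≥ γ for all x ∈ [−κ,κ], for some γ ∈ (0,∞). Suppose moreover that x³‖φ″‖_{L^∞(x/2,3x/2)} → 0 as x → +∞ and |x|³‖φ″‖_{L^∞(3x/2,x/2)} → 0 as x → −∞. Then limsup_{|x|→+∞} |x|^{1+2s} L_K φ(x) ≤ Λ·( C̄κ^{1−σ}/(σ−1) + ∫_{−κ}^{κ} φ(y) dy + C̄κ^{1−τ}/(τ−1) ), where Λ is the constant in (K2). -/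

import Mathlib

open MeasureTheory Filter Set Topology

/-- The principal value operator `L_K u (x)` (junk value if the limit does not exist). -/
noncomputable def LK (K u : ℝ → ℝ) (x : ℝ) : ℝ :=
  limUnder (nhdsWithin (0:ℝ) (Set.Ioi 0))
    (fun ε : ℝ => ∫ y in {y : ℝ | ε < |y - x|}, (u y - u x) * K (x - y))

theorem integrable_comp_abs {f : ℝ → ℝ} (hf : IntegrableOn f (Ioi 0)) :
    Integrable (fun x => f |x|) := by
  have h1 : IntegrableOn (fun x => f |x|) (Ioi 0) :=
    hf.congr_fun (fun x hx => by rw [abs_of_pos hx]) measurableSet_Ioi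
  have h2 : IntegrableOn (fun x => f |x|) (Iic 0) := by
    have := Iff.mpr integrableOn_Ici_iff_integrableOn_Ioi h1
    rw [← neg_zero] at this
    simpa using this.comp_neg_Iic
  rw [← integrableOn_univ, ← Iic_union_Ioi (a := (0:ℝ))]
  exact h2.union h1

theorem integrableOn_Ioi_indicator_Iio_rpow {a r : ℝ} (ha : -1 < a) (hr : 0 < r) :
    IntegrableOn ((Iio r).indicator fun t : ℝ => t ^ a) (Ioi 0) := by
  rw [IntegrableOn, integrable_indicator_iff measurableSet_Iio, IntegrableOn,
    Measure.restrict_restrict measurableSet_Iio, inter_comm, Ioi_inter_Iio]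
  exact (intervalIntegral.integrableOn_Ioo_rpow_iff hr).2 ha

theorem integral_Ioi_indicator_Iio_rpow {a r : ℝ} (ha : -1 < a) (hr : 0 < r) :
    ∫ t in Ioi 0, (Iio r).indicator (fun t : ℝ => t ^ a) t = r ^ (a + 1) / (a + 1) := by
  rw [integral_indicator measurableSet_Iio, Measure.restrict_restrict measurableSet_Iio,
    inter_comm, Ioi_inter_Iio, ← integral_Ioc_eq_integral_Ioo,
    ← intervalIntegral.integral_of_le hr.le, integral_rpow (Or.inl ha),
    Real.zero_rpow (by linarith), sub_zero]

theorem integrableOn_Ioi_indicator_Ici_rpow {a r : ℝ} (ha : a < -1) (hr : 0 < r) :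
    IntegrableOn ((Ici r).indicator fun t : ℝ => t ^ a) (Ioi 0) := by
  refine Integrable.integrableOn ?_
  rw [integrable_indicator_iff measurableSet_Ici, integrableOn_Ici_iff_integrableOn_Ioi]
  exact integrableOn_Ioi_rpow_of_lt ha hr

theorem abs_sub_le_of_abs_deriv_le {f : ℝ → ℝ} {L S a b u v : ℝ}
    (hf : ∀ x y, |f x - f y| ≤ L * |x - y|)
    (hS : ∀ y ∈ Ioo a b, |deriv f y| ≤ S) (hu : u ∈ Ioo a b) (hv : v ∈ Ioo a b) :
    |f v - f u| ≤ S * |v - u| := by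
  have hlip : LipschitzWith L.toNNReal f := LipschitzWith.of_dist_le_mul fun x y => by
    rw [Real.dist_eq, Real.dist_eq]
    exact (hf x y).trans (mul_le_mul_of_nonneg_right (Real.le_coe_toNNReal L) (abs_nonneg _))
  have hac : AbsolutelyContinuousOnInterval f u v :=
    hlip.lipschitzOnWith.absolutelyContinuousOnInterval
  rw [← hac.integral_deriv_eq_sub, ← Real.norm_eq_abs]
  refine intervalIntegral.norm_integral_le_of_norm_le_const fun x hx => hS x ?_
  exact ordConnected_Ioo.uIcc_subset hu hv (uIoc_subset_uIcc hx)

theorem abs_second_difference_le {f : ℝ → ℝ} {S a b x z : ℝ} (hf : Differentiable ℝ f)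
    (hS : ∀ u ∈ Ioo a b, ∀ v ∈ Ioo a b, |deriv f v - deriv f u| ≤ S * |v - u|) (hS0 : 0 ≤ S)
    (h1 : x + |z| < b) (h2 : a < x - |z|) :
    |f (x + z) + f (x - z) - 2 * f x| ≤ 2 * S * z ^ 2 := by
  have hd : ∀ t, HasDerivAt (fun t => f (x + t) + f (x - t))
      (deriv f (x + t) - deriv f (x - t)) t := fun t => by
    have e1 := (hf (x + t)).hasDerivAt.comp_const_add x t
    have e2 := (hf (x - t)).hasDerivAt.comp_const_sub x t
    rw [sub_eq_add_neg]
    exact e1.fun_add e2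
  have hm := (convex_uIcc (0:ℝ) z).norm_image_sub_le_of_norm_hasDerivWithin_le
    (f := fun t => f (x + t) + f (x - t)) (C := 2 * S * |z|)
    (fun t _ => (hd t).hasDerivWithinAt) (fun t ht => ?_) left_mem_uIcc right_mem_uIcc
  · simp only [add_zero, sub_zero, Real.norm_eq_abs] at hm
    calc _ = |f (x + z) + f (x - z) - (f x + f x)| := by ring_nf
      _ ≤ _ := hm
      _ = 2 * S * |z| ^ 2 := by ring
      _ = _ := by rw [sq_abs]
  · have htz : |t| ≤ |z| := by
      simpa using abs_sub_left_of_mem_uIcc ht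
    have h3 := abs_le.1 htz
    refine (hS (x - t) ⟨by linarith, by linarith⟩ (x + t) ⟨by linarith, by linarith⟩).trans ?_
    rw [show x + t - (x - t) = 2 * t by ring, abs_mul, abs_two]
    nlinarith

/-- The power `t ^ (2 - p)` cut off to `t < r`. -/
noncomputable def nearKernel (p r : ℝ) : ℝ → ℝ := (Iio r).indicator fun t => t ^ (2 - p)

/-- The power `t ^ (-p)` cut off to `r ≤ t`. -/
noncomputable def farKernel (p r : ℝ) : ℝ → ℝ := (Ici r).indicator fun t => t ^ (-p)

theorem integrable_nearKernel_abs {p r : ℝ} (hp : p < 3) (hr : 0 < r) :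
    Integrable fun z => nearKernel p r |z| :=
  integrable_comp_abs (integrableOn_Ioi_indicator_Iio_rpow (by linarith) hr)

theorem integral_nearKernel_abs {p r : ℝ} (hp : p < 3) (hr : 0 < r) :
    ∫ z, nearKernel p r |z| = 2 * (r ^ (3 - p) / (3 - p)) := by
  rw [integral_comp_abs, nearKernel, integral_Ioi_indicator_Iio_rpow (by linarith) hr]
  ring_nf

theorem integrable_farKernel_abs {p r : ℝ} (hp : 1 < p) (hr : 0 < r) :
    Integrable fun z => farKernel p r |z| :=
  integrable_comp_abs (integrableOn_Ioi_indicator_Ici_rpow (by linarith) hr)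

theorem farKernel_abs_nonneg (p r z : ℝ) : 0 ≤ farKernel p r |z| :=
  indicator_apply_nonneg fun _ => Real.rpow_nonneg (abs_nonneg z) _

theorem measurable_farKernel (p r : ℝ) : Measurable (farKernel p r) :=
  (measurable_id.pow_const (-p)).indicator measurableSet_Ici

theorem mul_le_near_add_far {p r Lam D V w k z : ℝ} (hz : z ≠ 0) (hk0 : 0 ≤ k)
    (hk : k ≤ Lam * |z| ^ (-p)) (hD : 0 ≤ D) (hV : 0 ≤ V)
    (hnear : |z| < r → w ≤ D * z ^ 2) (hfar : r ≤ |z| → w ≤ V) :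
    w * k ≤ Lam * (D * nearKernel p r |z| + V * farKernel p r |z|) := by
  have hz' : 0 < |z| := abs_pos.2 hz
  rcases lt_or_ge |z| r with h | h
  · rw [nearKernel, farKernel, indicator_of_mem (mem_Iio.2 h),
      indicator_of_notMem (by simpa using h), mul_zero, add_zero]
    calc w * k ≤ D * z ^ 2 * k := mul_le_mul_of_nonneg_right (hnear h) hk0
      _ ≤ D * z ^ 2 * (Lam * |z| ^ (-p)) := mul_le_mul_of_nonneg_left hk (by positivity)
      _ = Lam * (D * |z| ^ (2 - p)) := by
        rw [sub_eq_add_neg, Real.rpow_add hz', Real.rpow_two, sq_abs]; ring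
  · rw [nearKernel, farKernel, indicator_of_mem (mem_Ici.2 h),
      indicator_of_notMem (by simpa using h), mul_zero, zero_add]
    calc w * k ≤ V * k := mul_le_mul_of_nonneg_right (hfar h) hk0
      _ ≤ V * (Lam * |z| ^ (-p)) := mul_le_mul_of_nonneg_left hk hV
      _ = _ := by ring

section PrincipalValue

variable {K u : ℝ → ℝ} {p Lam B D x : ℝ}

theorem ae_ne_zero_real : ∀ᵐ z : ℝ, z ≠ 0 := by
  simp [ae_iff]

theorem integrable_second_difference_mul (hp1 : 1 < p) (hp3 : p < 3)
    (hKm : Measurable K) (hK : ∀ᵐ z, 0 ≤ K z ∧ K z ≤ Lam * |z| ^ (-p))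
    (hu : Continuous u) (hB : ∀ y, |u y| ≤ B) (hD0 : 0 ≤ D)
    (hD : ∀ z, |u (x + z) + u (x - z) - 2 * u x| ≤ D * z ^ 2) :
    Integrable fun z => (u (x + z) + u (x - z) - 2 * u x) * K z := by
  have hB0 : 0 ≤ B := (abs_nonneg _).trans (hB 0)
  have hbound : Integrable fun z =>
      Lam * (D * nearKernel p 1 |z| + 4 * B * farKernel p 1 |z|) :=
    (((integrable_nearKernel_abs hp3 one_pos).const_mul _).add
      ((integrable_farKernel_abs hp1 one_pos).const_mul _)).const_mul _
  refine hbound.mono' ?_ ?_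
  · have : Measurable u := hu.measurable
    exact Measurable.aestronglyMeasurable (by fun_prop)
  · filter_upwards [hK, ae_ne_zero_real] with z hz hz0
    rw [norm_mul, Real.norm_eq_abs, Real.norm_of_nonneg hz.1]
    refine mul_le_near_add_far hz0 hz.1 hz.2 hD0 (by positivity) (fun _ => hD z) fun _ => ?_
    have h1 := abs_le.1 (hB (x + z))
    have h2 := abs_le.1 (hB (x - z))
    have h3 := abs_le.1 (hB x)
    exact abs_le.2 ⟨by linarith, by linarith⟩

theorem integrableOn_difference_mul (hp1 : 1 < p) {ε : ℝ} (hε : 0 < ε)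
    (hKm : Measurable K) (hK : ∀ᵐ z, 0 ≤ K z ∧ K z ≤ Lam * |z| ^ (-p))
    (hu : Continuous u) (hB : ∀ y, |u y| ≤ B) {v : ℝ → ℝ} (hv : Measurable v) :
    IntegrableOn (fun z => (u (v z) - u x) * K z) {z : ℝ | ε < |z|} := by
  have hB0 : 0 ≤ B := (abs_nonneg _).trans (hB 0)
  have hbound : Integrable fun z => 2 * B * (Lam * farKernel p ε |z|) :=
    ((integrable_farKernel_abs hp1 hε).const_mul _).const_mul _
  have hset : MeasurableSet {z : ℝ | ε < |z|} := measurableSet_lt measurable_const (by fun_prop)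
  refine hbound.integrableOn.mono' ?_ ?_
  · have : Measurable u := hu.measurable
    exact Measurable.aestronglyMeasurable (by fun_prop)
  · filter_upwards [ae_restrict_of_ae hK, ae_restrict_mem hset] with z hz hzε
    rw [norm_mul, Real.norm_eq_abs, Real.norm_of_nonneg hz.1, farKernel,
      indicator_of_mem (mem_Ici.2 (le_of_lt hzε))]
    have h1 := abs_le.1 (hB (v z))
    have h3 := abs_le.1 (hB x)
    exact mul_le_mul (abs_le.2 ⟨by linarith, by linarith⟩) hz.2 hz.1 (by positivity)

theorem setIntegral_difference_mul_eq (hp1 : 1 < p) {ε : ℝ} (hε : 0 < ε)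
    (hKm : Measurable K) (hK1 : ∀ᵐ z, K (-z) = K z)
    (hK : ∀ᵐ z, 0 ≤ K z ∧ K z ≤ Lam * |z| ^ (-p))
    (hu : Continuous u) (hB : ∀ y, |u y| ≤ B) :
    ∫ y in {y : ℝ | ε < |y - x|}, (u y - u x) * K (x - y) =
      1 / 2 * ∫ z in {z : ℝ | ε < |z|}, (u (x + z) + u (x - z) - 2 * u x) * K z := by
  have hset : MeasurableSet {z : ℝ | ε < |z|} := measurableSet_lt measurable_const (by fun_prop)
  have hset' : MeasurableSet {y : ℝ | ε < |y - x|} :=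
    measurableSet_lt measurable_const (by fun_prop)
  have hplus : ∫ y in {y : ℝ | ε < |y - x|}, (u y - u x) * K (x - y) =
      ∫ z in {z : ℝ | ε < |z|}, (u (x + z) - u x) * K z := by
    rw [← integral_indicator hset', ← integral_indicator hset, ← integral_add_left_eq_self _ x]
    refine integral_congr_ae ?_
    filter_upwards [hK1] with z hz
    simp [indicator_apply, hz]
  have hminus : ∫ y in {y : ℝ | ε < |y - x|}, (u y - u x) * K (x - y) =
      ∫ z in {z : ℝ | ε < |z|}, (u (x - z) - u x) * K z := by
    rw [← integral_indicator hset', ← integral_indicator hset,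
      ← integral_sub_left_eq_self _ volume x]
    refine integral_congr_ae (Eventually.of_forall fun z => ?_)
    simp [indicator_apply]
  have hsum : ∫ z in {z : ℝ | ε < |z|}, (u (x + z) + u (x - z) - 2 * u x) * K z =
      (∫ z in {z : ℝ | ε < |z|}, (u (x + z) - u x) * K z) +
        ∫ z in {z : ℝ | ε < |z|}, (u (x - z) - u x) * K z := by
    rw [← integral_add (integrableOn_difference_mul hp1 hε hKm hK hu hB (by fun_prop))
      (integrableOn_difference_mul hp1 hε hKm hK hu hB (by fun_prop))]
    congr 1 with z
    ring
  rw [hsum, ← hplus, ← hminus]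
  ring

theorem LK_eq_integral_second_difference (hp1 : 1 < p) (hp3 : p < 3)
    (hKm : Measurable K) (hK1 : ∀ᵐ z, K (-z) = K z)
    (hK : ∀ᵐ z, 0 ≤ K z ∧ K z ≤ Lam * |z| ^ (-p))
    (hu : Continuous u) (hB : ∀ y, |u y| ≤ B) (hD0 : 0 ≤ D)
    (hD : ∀ z, |u (x + z) + u (x - z) - 2 * u x| ≤ D * z ^ 2) :
    LK K u x = 1 / 2 * ∫ z, (u (x + z) + u (x - z) - 2 * u x) * K z := by
  have hint := integrable_second_difference_mul hp1 hp3 hKm hK hu hB hD0 hD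
  have hset : ∀ ε : ℝ, MeasurableSet {z : ℝ | ε < |z|} := fun ε =>
    measurableSet_lt measurable_const (by fun_prop)
  refine Tendsto.limUnder_eq ?_
  have hlim : Tendsto (fun ε : ℝ => ∫ z in {z : ℝ | ε < |z|},
      (u (x + z) + u (x - z) - 2 * u x) * K z) (𝓝[>] 0)
      (𝓝 (∫ z, (u (x + z) + u (x - z) - 2 * u x) * K z)) := by
    simp_rw [← integral_indicator (hset _)]
    refine tendsto_integral_filter_of_dominated_convergence _
      (Eventually.of_forall fun ε => (hint.indicator (hset ε)).aestronglyMeasurable)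
      (Eventually.of_forall fun ε => Eventually.of_forall fun z => norm_indicator_le_norm_self _ z)
      hint.norm ?_
    filter_upwards [ae_ne_zero_real] with z hz
    refine tendsto_const_nhds.congr' ?_
    filter_upwards [mem_nhdsWithin_of_mem_nhds (Iio_mem_nhds (abs_pos.2 hz))] with ε hε
    have hmem : z ∈ {z : ℝ | ε < |z|} := hε
    rw [indicator_of_mem hmem]
  refine (hlim.const_mul (1 / 2)).congr' ?_
  filter_upwards [self_mem_nhdsWithin] with ε hε
  exact (setIntegral_difference_mul_eq hp1 hε hKm hK1 hK hu hB).symm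

end PrincipalValue

theorem tendsto_abs_rpow_mul_farKernel {p : ℝ} (y : ℝ) :
    Tendsto (fun x : ℝ => |x| ^ p * farKernel p (|x| / 2) |y - x|) (cocompact ℝ) (𝓝 1) := by
  have hinv : Tendsto (fun x : ℝ => x⁻¹) (cocompact ℝ) (𝓝 0) := by
    rw [← Metric.cobounded_eq_cocompact]
    exact tendsto_inv₀_cobounded
  have h1 : Tendsto (fun x : ℝ => |y * x⁻¹ - 1|) (cocompact ℝ) (𝓝 1) := by
    have := (((hinv).const_mul y).sub_const 1).abs
    simpa using this
  have h2 : Tendsto (fun x : ℝ => |y * x⁻¹ - 1| ^ (-p)) (cocompact ℝ) (𝓝 1) := by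
    simpa using h1.rpow_const (p := -p) (Or.inl one_ne_zero)
  refine h2.congr' ?_
  filter_upwards [h1.eventually (lt_mem_nhds (show (1 / 2 : ℝ) < 1 by norm_num)),
    (isCompact_singleton (x := (0:ℝ))).compl_mem_cocompact] with x hx hx0
  have hx0' : x ≠ 0 := hx0
  have hpos : 0 < |x| := abs_pos.2 hx0'
  have hyx : |y - x| = |x| * |y * x⁻¹ - 1| := by
    rw [← abs_mul]; congr 1; field_simp
  have hmem : |y - x| ∈ Ici (|x| / 2) := by
    rw [mem_Ici, hyx]; nlinarith
  rw [farKernel, indicator_of_mem hmem, hyx, Real.mul_rpow hpos.le (abs_nonneg _), ← mul_assoc,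
    ← Real.rpow_add hpos]
  simp

theorem abs_rpow_mul_farKernel_le {p : ℝ} (hp : 0 < p) (x y : ℝ) :
    |x| ^ p * farKernel p (|x| / 2) |y - x| ≤ 2 ^ p := by
  by_cases h : |x| / 2 ≤ |y - x|
  · rw [farKernel, indicator_of_mem (mem_Ici.2 h), Real.rpow_neg (abs_nonneg _), ← div_eq_mul_inv,
      ← Real.div_rpow (abs_nonneg _) (abs_nonneg _)]
    refine Real.rpow_le_rpow (by positivity) (div_le_of_le_mul₀ (abs_nonneg _) zero_le_two ?_) hp.le
    linarith
  · rw [farKernel, indicator_of_notMem (by simpa using h), mul_zero]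
    positivity

theorem tendsto_integral_mul_farKernel {p : ℝ} (hp : 0 < p) {u : ℝ → ℝ} (hu : Integrable u) :
    Tendsto (fun x : ℝ => ∫ y, u y * (|x| ^ p * farKernel p (|x| / 2) |y - x|)) (cocompact ℝ)
      (𝓝 (∫ y, u y)) := by
  have : (cocompact ℝ).IsCountablyGenerated := by
    rw [cocompact_eq_atBot_atTop]; infer_instance
  refine tendsto_integral_filter_of_dominated_convergence (fun y => ‖u y‖ * 2 ^ p)
    (Eventually.of_forall fun x => ?_)
    (Eventually.of_forall fun x => Eventually.of_forall fun y => ?_)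
    (hu.norm.mul_const _) (Eventually.of_forall fun y => ?_)
  · have := (measurable_farKernel p (|x| / 2)).comp (f := fun y : ℝ => |y - x|) (by fun_prop)
    exact hu.aestronglyMeasurable.mul (this.const_mul _).aestronglyMeasurable
  · rw [norm_mul, Real.norm_of_nonneg
      (mul_nonneg (by positivity) (farKernel_abs_nonneg p _ _))]
    exact mul_le_mul_of_nonneg_left (abs_rpow_mul_farKernel_le hp x y) (norm_nonneg _)
  · simpa using (tendsto_abs_rpow_mul_farKernel (p := p) y).const_mul (u y)

theorem abs_rpow_mul_LK_le {K u : ℝ → ℝ} {p Lam B D T x : ℝ} (hp1 : 1 < p) (hp3 : p < 3)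
    (hKm : Measurable K) (hK1 : ∀ᵐ z, K (-z) = K z)
    (hK : ∀ᵐ z, 0 ≤ K z ∧ K z ≤ Lam * |z| ^ (-p))
    (hu : Continuous u) (hu0 : ∀ y, 0 ≤ u y) (hB : ∀ y, |u y| ≤ B) (hD0 : 0 ≤ D)
    (hD : ∀ z, |u (x + z) + u (x - z) - 2 * u x| ≤ D * z ^ 2) (hx : x ≠ 0) (hT0 : 0 ≤ T)
    (hT : ∀ z, |z| < |x| / 2 → |u (x + z) + u (x - z) - 2 * u x| ≤ 2 * T * z ^ 2) :
    |x| ^ p * LK K u x ≤ Lam * (2 * (1 / 2) ^ (3 - p) / (3 - p)) * (|x| ^ 3 * T) +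
      Lam * ∫ y, u y * (|x| ^ p * farKernel p (|x| / 2) |y - x|) := by
  have hxpos : 0 < |x| := abs_pos.2 hx
  set r := |x| / 2 with hr
  have hrpos : 0 < r := by positivity
  have hfar := integrable_farKernel_abs hp1 hrpos
  have hint : ∀ v : ℝ → ℝ, Continuous v →
      Integrable fun z => u (v z) * farKernel p r |z| := fun v hv => by
    refine (hfar.const_mul B).mono'
      ((hu.comp hv).aestronglyMeasurable.mul hfar.aestronglyMeasurable)
      (Eventually.of_forall fun z => ?_)
    rw [norm_mul, Real.norm_of_nonneg (farKernel_abs_nonneg p r z)]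
    exact mul_le_mul_of_nonneg_right (hB _) (farKernel_abs_nonneg p r z)
  have hplus := hint (fun z => x + z) (by fun_prop)
  have hminus := hint (fun z => x - z) (by fun_prop)
  have hnear := integrable_nearKernel_abs hp3 hrpos
  have eplus : ∫ z, u (x + z) * farKernel p r |z| = ∫ y, u y * farKernel p r |y - x| := by
    rw [← integral_add_left_eq_self (fun y => u y * farKernel p r |y - x|) x]
    simp
  have eminus : ∫ z, u (x - z) * farKernel p r |z| = ∫ y, u y * farKernel p r |y - x| := by
    rw [← integral_sub_left_eq_self (fun y => u y * farKernel p r |y - x|) volume x]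
    simp
  have hmono : ∫ z, (u (x + z) + u (x - z) - 2 * u x) * K z ≤
      ∫ z, Lam * (2 * T * nearKernel p r |z| +
        (u (x + z) * farKernel p r |z| + u (x - z) * farKernel p r |z|)) := by
    refine integral_mono_ae (integrable_second_difference_mul hp1 hp3 hKm hK hu hB hD0 hD)
      (((hnear.const_mul _).add (hplus.add hminus)).const_mul _) ?_
    filter_upwards [hK, ae_ne_zero_real] with z hz hz0
    rw [← add_mul]
    refine mul_le_near_add_far hz0 hz.1 hz.2 (by positivity) (add_nonneg (hu0 _) (hu0 _))
      (fun h => (le_abs_self _).trans (hT z h)) fun _ => ?_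
    linarith [hu0 x]
  rw [integral_const_mul, integral_add (hnear.const_mul _) (hplus.fun_add hminus),
    integral_add hplus hminus, integral_const_mul, eplus, eminus,
    integral_nearKernel_abs hp3 hrpos] at hmono
  have hJ : ∫ y, u y * (|x| ^ p * farKernel p r |y - x|) =
      |x| ^ p * ∫ y, u y * farKernel p r |y - x| := by
    rw [← integral_const_mul]
    congr 1 with y
    ring
  have hpow : |x| ^ p * r ^ (3 - p) = (1 / 2) ^ (3 - p) * |x| ^ 3 := by
    rw [hr, div_eq_mul_one_div, Real.mul_rpow hxpos.le (by norm_num), ← mul_assoc,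
      ← Real.rpow_add hxpos, add_sub_cancel, mul_comm]
    norm_cast
  rw [LK_eq_integral_second_difference hp1 hp3 hKm hK1 hK hu hB hD0 hD, hJ]
  set J := ∫ y, u y * farKernel p r |y - x|
  calc _ ≤ |x| ^ p * (1 / 2 * (Lam * (2 * T * (2 * (r ^ (3 - p) / (3 - p))) + (J + J)))) := by
        gcongr
    _ = Lam * (2 * T / (3 - p)) * (|x| ^ p * r ^ (3 - p)) + Lam * (|x| ^ p * J) := by ring
    _ = _ := by rw [hpow]; ring

theorem integrableOn_Ioi_and_integral_le {f : ℝ → ℝ} {C κ τ : ℝ} (hκ : 0 < κ) (hτ : 1 < τ)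
    (hf : Continuous f) (hf0 : ∀ x, 0 ≤ f x) (hle : ∀ x > κ, f x ≤ C * x ^ (-τ)) :
    IntegrableOn f (Ioi κ) ∧ ∫ x in Ioi κ, f x ≤ C * κ ^ (1 - τ) / (τ - 1) := by
  have hpow : IntegrableOn (fun x : ℝ => C * x ^ (-τ)) (Ioi κ) :=
    (integrableOn_Ioi_rpow_of_lt (by linarith) hκ).const_mul C
  have hint : IntegrableOn f (Ioi κ) := by
    refine hpow.mono' hf.aestronglyMeasurable ?_
    filter_upwards [ae_restrict_mem measurableSet_Ioi] with x hx
    rw [Real.norm_of_nonneg (hf0 x)]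
    exact hle x hx
  refine ⟨hint, (setIntegral_mono_on hint hpow measurableSet_Ioi hle).trans_eq ?_⟩
  rw [integral_const_mul, integral_Ioi_rpow_of_lt (by linarith) hκ, neg_add_eq_sub,
    ← neg_sub τ 1, div_neg, neg_div, neg_neg, mul_div_assoc, neg_sub]

theorem integrable_and_integral_le {f : ℝ → ℝ} {C κ σ τ : ℝ} (hκ : 0 < κ) (hσ : 1 < σ)
    (hτ : 1 < τ) (hf : Continuous f) (hf0 : ∀ x, 0 ≤ f x)
    (hle1 : ∀ x < -κ, f x ≤ C * |x| ^ (-σ)) (hle2 : ∀ x > κ, f x ≤ C * |x| ^ (-τ)) :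
    Integrable f ∧ ∫ x, f x ≤
      C * κ ^ (1 - σ) / (σ - 1) + (∫ x in (-κ)..κ, f x) + C * κ ^ (1 - τ) / (τ - 1) := by
  obtain ⟨hi2, hb2⟩ := integrableOn_Ioi_and_integral_le (C := C) hκ hτ hf hf0 fun x hx => by
    simpa [abs_of_pos (hκ.trans hx)] using hle2 x hx
  obtain ⟨hi1, hb1⟩ := integrableOn_Ioi_and_integral_le (f := fun x => f (-x)) (C := C) hκ hσ
    (by fun_prop) (fun x => hf0 _) fun x hx => by
      simpa [abs_of_pos (hκ.trans hx)] using hle1 (-x) (neg_lt_neg hx)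
  rw [integral_comp_neg_Ioi] at hb1
  have hi1' : IntegrableOn f (Iic (-κ)) := by
    have := Iff.mpr integrableOn_Ici_iff_integrableOn_Ioi hi1
    rw [← neg_neg κ] at this
    simpa using this.comp_neg_Iic
  have hmid : IntegrableOn f (Ioc (-κ) κ) :=
    (hf.intervalIntegrable (-κ) κ).1
  have hi3 : IntegrableOn f (Ioi (-κ)) := by
    rw [← Ioc_union_Ioi_eq_Ioi (show -κ ≤ κ by linarith)]
    exact hmid.union hi2
  have hi : Integrable f := by
    rw [← integrableOn_univ, ← Iic_union_Ioi (a := -κ)]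
    exact hi1'.union hi3
  refine ⟨hi, ?_⟩
  rw [← intervalIntegral.integral_Iic_add_Ioi hi1' hi3, ← Ioc_union_Ioi_eq_Ioi
    (show -κ ≤ κ by linarith), setIntegral_union (by
      rw [disjoint_left]; exact fun x hx hx' => absurd hx.2 (not_le.2 hx')) measurableSet_Ioi
      hmid hi2, ← intervalIntegral.integral_of_le (by linarith)]
  linarith

theorem exists_abs_le_of_tail_le {f : ℝ → ℝ} {C κ σ τ : ℝ} (hκ : 0 < κ) (hσ : 0 ≤ σ)
    (hτ : 0 ≤ τ) (hC : 0 ≤ C) (hf : Continuous f) (hf0 : ∀ x, 0 ≤ f x)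
    (hle1 : ∀ x < -κ, f x ≤ C * |x| ^ (-σ)) (hle2 : ∀ x > κ, f x ≤ C * |x| ^ (-τ)) :
    ∃ B, ∀ x, |f x| ≤ B := by
  obtain ⟨M, hM⟩ := (isCompact_Icc (a := -κ) (b := κ)).exists_bound_of_continuousOn hf.continuousOn
  refine ⟨max M (max (C * κ ^ (-σ)) (C * κ ^ (-τ))), fun x => ?_⟩
  rcases lt_or_ge x (-κ) with h1 | h1
  · rw [abs_of_nonneg (hf0 x)]
    refine (hle1 x h1).trans (le_max_of_le_right (le_max_of_le_left ?_))
    refine mul_le_mul_of_nonneg_left (Real.rpow_le_rpow_of_nonpos hκ ?_ (by linarith)) hC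
    rw [abs_of_neg (by linarith)]; linarith
  rcases lt_or_ge κ x with h2 | h2
  · rw [abs_of_nonneg (hf0 x)]
    refine (hle2 x h2).trans (le_max_of_le_right (le_max_of_le_right ?_))
    refine mul_le_mul_of_nonneg_left (Real.rpow_le_rpow_of_nonpos hκ ?_ (by linarith)) hC
    rw [abs_of_pos (by linarith)]; linarith
  · exact le_max_of_le_left (hM x ⟨h1, h2⟩)

theorem tendsto_cube_mul_sSup_abs_cocompact {f : ℝ → ℝ}
    (h1 : Tendsto (fun x : ℝ => x ^ 3 * sSup ((fun y => |f y|) '' Ioo (x / 2) (3 * x / 2)))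
      atTop (𝓝 0))
    (h2 : Tendsto (fun x : ℝ => |x| ^ 3 * sSup ((fun y => |f y|) '' Ioo (3 * x / 2) (x / 2)))
      atBot (𝓝 0)) :
    Tendsto (fun x : ℝ => |x| ^ 3 *
      sSup ((fun y => |f y|) '' Ioo (x - |x| / 2) (x + |x| / 2))) (cocompact ℝ) (𝓝 0) := by
  rw [cocompact_eq_atBot_atTop, tendsto_sup]
  constructor
  · refine h2.congr' ?_
    filter_upwards [eventually_lt_atBot 0] with x hx
    rw [abs_of_neg hx, show x - -x / 2 = 3 * x / 2 by ring, show x + -x / 2 = x / 2 by ring]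
  · refine h1.congr' ?_
    filter_upwards [eventually_gt_atTop 0] with x hx
    rw [abs_of_pos hx, show x - x / 2 = x / 2 by ring, show x + x / 2 = 3 * x / 2 by ring]

theorem upper_asymptotic_bound (s lam Lam : ℝ)
    (hs : s ∈ Set.Ioo (0:ℝ) 1) (hlam : 0 < lam) (hlL : lam ≤ Lam)
    (K : ℝ → ℝ) (hKmeas : Measurable K)
    (hK1 : ∀ᵐ x : ℝ, K (-x) = K x)
    (hK2 : ∀ᵐ x : ℝ, lam / |x| ^ (1 + 2*s) ≤ K x ∧ K x ≤ Lam / |x| ^ (1 + 2*s))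
    (Cb κ σ τ γ : ℝ) (hCb : 0 < Cb) (hκ : 0 < κ) (hσ : 1 < σ) (hτ : 1 < τ) (hγ : 0 < γ)
    -- φ ∈ C^{1,1}(ℝ): differentiable with bounded Lipschitz derivative
    (φ : ℝ → ℝ) (hφdiff : Differentiable ℝ φ)
    (hφ'bdd : ∃ M : ℝ, ∀ x, |deriv φ x| ≤ M)
    (hφ'lip : ∃ L : ℝ, ∀ x y : ℝ, |deriv φ x - deriv φ y| ≤ L * |x - y|)
    (hφnn : ∀ x, 0 ≤ φ x)
    (hup1 : ∀ x < -κ, φ x ≤ Cb * |x| ^ (-σ))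
    (hup2 : ∀ x > κ, φ x ≤ Cb * |x| ^ (-τ))
    (hlow : ∀ x ∈ Set.Icc (-κ) κ, γ ≤ φ x)
    (hsec1 : Tendsto (fun x : ℝ =>
        x ^ 3 * sSup ((fun y => |deriv (deriv φ) y|) '' Set.Ioo (x/2) (3*x/2)))
      atTop (𝓝 0))
    (hsec2 : Tendsto (fun x : ℝ =>
        |x| ^ 3 * sSup ((fun y => |deriv (deriv φ) y|) '' Set.Ioo (3*x/2) (x/2)))
      atBot (𝓝 0)) :
    -- limsup_{|x|→∞} |x|^{1+2s} L_K φ(x) ≤ Λ (C̄κ^{1-σ}/(σ-1) + ∫_{-κ}^{κ} φ + C̄κ^{1-τ}/(τ-1))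
    ∀ c > Lam * (Cb * κ ^ (1-σ) / (σ-1) + (∫ y in (-κ)..κ, φ y) + Cb * κ ^ (1-τ) / (τ-1)),
      ∀ᶠ x in cocompact ℝ, |x| ^ (1 + 2*s) * LK K φ x ≤ c := by
  intro c hc
  obtain ⟨L, hL⟩ := hφ'lip
  have hL0 : 0 ≤ L := by simpa using (abs_nonneg _).trans (hL 1 0)
  have hLam : 0 < Lam := hlam.trans_le hlL
  have hp1 : 1 < 1 + 2 * s := by linarith [hs.1]
  have hp3 : 1 + 2 * s < 3 := by linarith [hs.2]
  have hcont := hφdiff.continuous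
  have hK : ∀ᵐ z, 0 ≤ K z ∧ K z ≤ Lam * |z| ^ (-(1 + 2 * s)) := by
    filter_upwards [hK2] with z hz
    rw [Real.rpow_neg (abs_nonneg z), ← div_eq_mul_inv]
    exact ⟨le_trans (by positivity) hz.1, hz.2⟩
  obtain ⟨B, hB⟩ := exists_abs_le_of_tail_le hκ (by linarith) (by linarith) hCb.le hcont hφnn
    hup1 hup2
  obtain ⟨hint, hmass⟩ := integrable_and_integral_le hκ hσ hτ hcont hφnn hup1 hup2
  have hD : ∀ x z, |φ (x + z) + φ (x - z) - 2 * φ x| ≤ 2 * L * z ^ 2 := fun x z =>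
    abs_second_difference_le (a := x - |z| - 1) (b := x + |z| + 1) hφdiff
      (fun u _ v _ => hL v u) hL0 (by linarith) (by linarith)
  have hderiv : ∀ y, |deriv (deriv φ) y| ≤ L := fun y => by
    have hlip : LipschitzWith L.toNNReal (deriv φ) := LipschitzWith.of_dist_le_mul fun x y => by
      rw [Real.dist_eq, Real.dist_eq, Real.coe_toNNReal L hL0]
      exact hL x y
    simpa [hL0] using norm_deriv_le_of_lipschitz (x₀ := y) hlip
  have hsec := tendsto_cube_mul_sSup_abs_cocompact hsec1 hsec2
  set T : ℝ → ℝ := fun x =>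
    sSup ((fun y => |deriv (deriv φ) y|) '' Ioo (x - |x| / 2) (x + |x| / 2))
  have hT0 : ∀ x, 0 ≤ T x := fun x => Real.sSup_nonneg (by rintro _ ⟨y, _, rfl⟩; positivity)
  have hT : ∀ x z, |z| < |x| / 2 →
      |φ (x + z) + φ (x - z) - 2 * φ x| ≤ 2 * T x * z ^ 2 := fun x z hz => by
    refine abs_second_difference_le (a := x - |x| / 2) (b := x + |x| / 2) hφdiff
      (fun u hu v hv => abs_sub_le_of_abs_deriv_le hL (fun y hy => ?_) hu hv) (hT0 x)
      (by linarith) (by linarith)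
    exact le_csSup ⟨L, by rintro _ ⟨y, _, rfl⟩; exact hderiv y⟩ (mem_image_of_mem _ hy)
  have hlim := (hsec.const_mul
      (Lam * (2 * (1 / 2) ^ (3 - (1 + 2 * s)) / (3 - (1 + 2 * s))))).add
    ((tendsto_integral_mul_farKernel (by linarith : 0 < 1 + 2 * s) hint).const_mul Lam)
  rw [mul_zero, zero_add] at hlim
  have hlt : Lam * ∫ y, φ y < c := (mul_le_mul_of_nonneg_left hmass hLam.le).trans_lt hc
  filter_upwards [hlim.eventually (gt_mem_nhds hlt),
    (isCompact_singleton (x := (0 : ℝ))).compl_mem_cocompact] with x hx hx0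
  exact (abs_rpow_mul_LK_le hp1 hp3 hKmeas hK1 hK hcont hφnn hB (by positivity) (hD x)
    hx0 (hT0 x) (hT x)).trans hx.le
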